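/- (The extended measure equals the outer measure on limits.) Let {B_n} be a μ-Cauchy sequence in Ω and let S ⊆ X satisfy lim_{n→∞} μ*(B_n △ S) = 0. Then the limit lim_{n→∞} μ(B_n) exists and equals μ*(S). -/

import Mathlib

open Filter Set Topology
open scoped symmDiff ENNReal

/-- `Ω` is an algebra of sets on `X`: it contains `∅` and is closed under
complements and finite unions. -/
def IsSetAlgebraOn {X : Type*} (Ω : Set (Set X)) : Prop :=
  ∅ ∈ Ω ∧ (∀ A ∈ Ω, Aᶜ ∈ Ω) ∧ (∀ A ∈ Ω, ∀ B ∈ Ω, A ∪ B ∈ Ω)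

/-- `μ` is a countably additive measure on the algebra `Ω`. -/
def IsCountablyAdditiveOn {X : Type*} (Ω : Set (Set X)) (μ : Set X → ℝ≥0∞) : Prop :=
  μ ∅ = 0 ∧ ∀ A : ℕ → Set X, (∀ i, A i ∈ Ω) → Pairwise (Function.onFun Disjoint A) →
    (⋃ i, A i) ∈ Ω → μ (⋃ i, A i) = ∑' i, μ (A i)

/-- The outer measure induced by `μ`:
`μ*(A) = inf { ∑ μ(Cᵢ) : A ⊆ ⋃ᵢ Cᵢ, Cᵢ ∈ Ω }`. -/
noncomputable def muStar {X : Type*} (Ω : Set (Set X)) (μ : Set X → ℝ≥0∞)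
    (A : Set X) : ℝ≥0∞ :=
  ⨅ (C : ℕ → Set X) (_ : ∀ i, C i ∈ Ω) (_ : A ⊆ ⋃ i, C i), ∑' i, μ (C i)

/-- A `μ`-Cauchy sequence in `Ω`: a sequence of members of `Ω` with
`μ(B n ∆ B m) → 0` as `n, m → ∞`. -/
def MuCauchy {X : Type*} (Ω : Set (Set X)) (μ : Set X → ℝ≥0∞) (B : ℕ → Set X) : Prop :=
  (∀ n, B n ∈ Ω) ∧ Tendsto (fun p : ℕ × ℕ => μ (B p.1 ∆ B p.2)) atTop (𝓝 0)

/-- `S̃`: the collection of subsets of `X` that are limits (in the pseudometric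
`d(A,B) = μ*(A ∆ B)`) of `μ`-Cauchy sequences from `Ω`. -/
def Stilde {X : Type*} (Ω : Set (Set X)) (μ : Set X → ℝ≥0∞) : Set (Set X) :=
  {S | ∃ B : ℕ → Set X, MuCauchy Ω μ B ∧
    Tendsto (fun n => muStar Ω μ (B n ∆ S)) atTop (𝓝 0)}

namespace IsSetAlgebraOn

variable {X : Type*} {Ω : Set (Set X)}

theorem inter_mem (hΩ : IsSetAlgebraOn Ω) {A B : Set X} (hA : A ∈ Ω) (hB : B ∈ Ω) :
    A ∩ B ∈ Ω := by
  have h := hΩ.2.1 _ (hΩ.2.2 _ (hΩ.2.1 _ hA) _ (hΩ.2.1 _ hB))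
  rwa [compl_union, compl_compl, compl_compl] at h

theorem diff_mem (hΩ : IsSetAlgebraOn Ω) {A B : Set X} (hA : A ∈ Ω) (hB : B ∈ Ω) :
    A \ B ∈ Ω :=
  hΩ.inter_mem hA (hΩ.2.1 _ hB)

theorem disjointed_mem (hΩ : IsSetAlgebraOn Ω) {C : ℕ → Set X} (hC : ∀ i, C i ∈ Ω) (n : ℕ) :
    disjointed C n ∈ Ω :=
  disjointedRec (p := (· ∈ Ω)) (fun _ i h => hΩ.diff_mem h (hC i)) (hC n)

end IsSetAlgebraOn

section InducedOuterMeasure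

variable {X : Type*} {Ω : Set (Set X)} {μ : Set X → ℝ≥0∞}

theorem IsCountablyAdditiveOn.mono (hΩ : IsSetAlgebraOn Ω) (hμ : IsCountablyAdditiveOn Ω μ)
    {A B : Set X} (hA : A ∈ Ω) (hB : B ∈ Ω) (hAB : A ⊆ B) : μ A ≤ μ B := by
  let D : ℕ → Set X := fun n => if n = 0 then A else if n = 1 then B \ A else ∅
  have hD : ∀ i, D i ∈ Ω := by
    intro i
    dsimp only [D]
    split_ifs
    exacts [hA, hΩ.diff_mem hB hA, hΩ.1]
  have hdisj : Pairwise (Function.onFun Disjoint D) := by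
    intro i j hij
    rw [Function.onFun, Set.disjoint_left]
    intro x
    dsimp only [D]
    split_ifs <;> simp_all
  have hU : ⋃ i, D i = B := by
    apply Set.Subset.antisymm
    · refine iUnion_subset fun i => ?_
      dsimp only [D]
      split_ifs
      exacts [hAB, sdiff_subset, empty_subset _]
    · intro x hx
      by_cases hxA : x ∈ A
      · exact mem_iUnion.2 ⟨0, by simpa [D] using hxA⟩
      · exact mem_iUnion.2 ⟨1, by simpa [D] using ⟨hx, hxA⟩⟩
  have h := hμ.2 D hD hdisj (hU ▸ hB)
  rw [hU] at h
  rw [h]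
  exact ENNReal.le_tsum (f := fun i => μ (D i)) 0

theorem muStar_eq_of_mem (hΩ : IsSetAlgebraOn Ω) (hμ : IsCountablyAdditiveOn Ω μ)
    {A : Set X} (hA : A ∈ Ω) : muStar Ω μ A = μ A := by
  apply le_antisymm
  · refine iInf_le_of_le (fun n => if n = 0 then A else ∅) <| iInf_le_of_le ?_ <|
      iInf_le_of_le ?_ ?_
    · intro i
      dsimp only
      split_ifs
      exacts [hA, hΩ.1]
    · exact fun x hx => mem_iUnion.2 ⟨0, by simpa using hx⟩
    · rw [tsum_eq_single 0 fun n hn => by simp [hn, hμ.1]]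
      simp
  · refine le_iInf fun C => le_iInf fun hC => le_iInf fun hAC => ?_
    have hD : ∀ i, A ∩ disjointed C i ∈ Ω := fun i => hΩ.inter_mem hA (hΩ.disjointed_mem hC i)
    have hU : ⋃ i, A ∩ disjointed C i = A := by
      rw [← inter_iUnion, iUnion_disjointed, inter_eq_left.2 hAC]
    have h := hμ.2 (fun i => A ∩ disjointed C i) hD
      (fun i j hij => (disjoint_disjointed C hij).mono inter_subset_right inter_subset_right)
      (hU.symm ▸ hA)
    rw [hU] at h
    rw [h]
    exact ENNReal.tsum_le_tsum fun i => hμ.mono hΩ (hD i) (hC i)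
      (inter_subset_right.trans (disjointed_subset C i))

open Classical in
/-- `muStar` is the Carathéodory outer measure of `μ` extended by `∞` off `Ω`. -/
theorem muStar_eq_ofFunction (hΩ : IsSetAlgebraOn Ω) (hμ : IsCountablyAdditiveOn Ω μ)
    (A : Set X) :
    muStar Ω μ A = MeasureTheory.OuterMeasure.ofFunction
      (fun s => if s ∈ Ω then μ s else ⊤) (by simp [hΩ.1, hμ.1]) A := by
  rw [MeasureTheory.OuterMeasure.ofFunction_apply]
  refine iInf_congr fun C => ?_
  by_cases hC : ∀ i, C i ∈ Ω
  · simp [hC]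
  · obtain ⟨i, hi⟩ := not_forall.1 hC
    have htop : ∑' i, (if C i ∈ Ω then μ (C i) else ⊤) = ⊤ :=
      ENNReal.tsum_eq_top_of_eq_top ⟨i, by simp [hi]⟩
    simp [hC, htop]

theorem muStar_le_add_of_subset_union (hΩ : IsSetAlgebraOn Ω) (hμ : IsCountablyAdditiveOn Ω μ)
    {A B C : Set X} (h : A ⊆ B ∪ C) : muStar Ω μ A ≤ muStar Ω μ B + muStar Ω μ C := by
  simp only [muStar_eq_ofFunction hΩ hμ]
  exact (MeasureTheory.measure_mono h).trans (MeasureTheory.measure_union_le B C)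

end InducedOuterMeasure

/-- the extended measure equals the outer measure on limits. -/
theorem stmt5 {X : Type*} (Ω : Set (Set X)) (μ : Set X → ℝ≥0∞)
    (hΩ : IsSetAlgebraOn Ω) (hμ : IsCountablyAdditiveOn Ω μ) (hfin : μ Set.univ ≠ ⊤)
    (B : ℕ → Set X) (hB : MuCauchy Ω μ B)
    (S : Set X)
    (hS : Tendsto (fun n => muStar Ω μ (B n ∆ S)) atTop (𝓝 0)) :
    Tendsto (fun n => μ (B n)) atTop (𝓝 (muStar Ω μ S)) := by
  have hlower (n : ℕ) : muStar Ω μ S - muStar Ω μ (B n ∆ S) ≤ μ (B n) := by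
    rw [tsub_le_iff_right, ← muStar_eq_of_mem hΩ hμ (hB.1 n)]
    refine muStar_le_add_of_subset_union hΩ hμ fun x hx => ?_
    by_cases hxB : x ∈ B n
    · exact Or.inl hxB
    · exact Or.inr (Or.inr ⟨hx, hxB⟩)
  have hupper (n : ℕ) : μ (B n) ≤ muStar Ω μ S + muStar Ω μ (B n ∆ S) := by
    rw [← muStar_eq_of_mem hΩ hμ (hB.1 n)]
    refine muStar_le_add_of_subset_union hΩ hμ fun x hx => ?_
    by_cases hxS : x ∈ S
    · exact Or.inl hxS
    · exact Or.inr (Or.inl ⟨hx, hxS⟩)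
  refine tendsto_of_tendsto_of_tendsto_of_le_of_le ?_ ?_ hlower hupper
  · simpa using ENNReal.Tendsto.sub (tendsto_const_nhds (x := muStar Ω μ S)) hS
      (Or.inr ENNReal.zero_ne_top)
  · simpa using (tendsto_const_nhds (x := muStar Ω μ S)).add hS
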